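/- Fix real numbers n > 0, p > 0, q > 0, d > 0 and μ ∈ ℝ, and let D = p/(p+q) and B = √(np+1) + √(npD + D²). Define PT^opt = d·μ²·(1/(np))² + d·(√((np+1)/(n²p²)) − 1)² and, for k ∈ ℝ, PT(k) = d·μ²·[(1/(n(p+q)))·((1+k)/2) + ((p−q)/(p+q))·((1−k)/2)]² + d·(√((n(p+q)+1)/(n²(p+q)²)) − 1)². Then PT^opt − PT(k) tends to d·[((1+D)/(n²p²))·μ² + ((np+1+D)·(B − 2np))/(n²p²·B)]·(1 − D) as k tends to 1. -/

import Mathlib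

open Filter Topology

theorem Real.sqrt_div_sub_one_sq_sub_sq {a b m : ℝ} (ha : 0 < a) (hb : 0 ≤ b) (hm : 0 < m) :
    (√(a / m ^ 2) - 1) ^ 2 - (√(b / m ^ 2) - 1) ^ 2
      = (a - b) * (√a + √b - 2 * m) / (m ^ 2 * (√a + √b)) := by
  have hpos : 0 < √a + √b := add_pos_of_pos_of_nonneg (Real.sqrt_pos.2 ha) (Real.sqrt_nonneg b)
  have hab : a - b = (√a - √b) * (√a + √b) := by
    linear_combination -(Real.sq_sqrt ha.le) + Real.sq_sqrt hb
  rw [Real.sqrt_div ha.le, Real.sqrt_div hb, Real.sqrt_sq hm.le, hab]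
  field_simp
  ring

/-- As k tends to 1, the privacy-theft gap PT^opt − PT(k) tends to the closed form
d·[((1+D)/(n²p²))·μ² + ((np+1+D)·(B − 2np))/(n²p²·B)]·(1 − D). -/
theorem stmt_2 (n p q d μ : ℝ) (hn : 0 < n) (hp : 0 < p) (hq : 0 < q) (hd : 0 < d)
    (D B : ℝ) (hD : D = p / (p + q))
    (hB : B = Real.sqrt (n * p + 1) + Real.sqrt (n * p * D + D ^ 2)) :
    Tendsto
      (fun k : ℝ =>
        (d * μ ^ 2 * (1 / (n * p)) ^ 2
            + d * (Real.sqrt ((n * p + 1) / (n ^ 2 * p ^ 2)) - 1) ^ 2)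
          - (d * μ ^ 2
                * (1 / (n * (p + q)) * ((1 + k) / 2)
                    + (p - q) / (p + q) * ((1 - k) / 2)) ^ 2
              + d * (Real.sqrt ((n * (p + q) + 1) / (n ^ 2 * (p + q) ^ 2)) - 1) ^ 2))
      (nhds 1)
      (nhds (d * ((1 + D) / (n ^ 2 * p ^ 2) * μ ^ 2
          + (n * p + 1 + D) * (B - 2 * n * p) / (n ^ 2 * p ^ 2 * B)) * (1 - D))) := by
  have hm : 0 < n * p := mul_pos hn hp
  have hD0 : 0 < D := hD ▸ div_pos hp (add_pos hp hq)
  have hinv : 1 / (n * (p + q)) = D / (n * p) := by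
    rw [hD]
    field_simp
  have hdensity : (n * (p + q) + 1) / (n ^ 2 * (p + q) ^ 2)
      = (n * p * D + D ^ 2) / (n * p) ^ 2 := by
    rw [hD]
    field_simp
  have hgap := Real.sqrt_div_sub_one_sq_sub_sq (a := n * p + 1) (b := n * p * D + D ^ 2)
    (by positivity) (by positivity) hm
  have hB0 : 0 < B := by
    rw [hB]
    positivity
  rw [← hB] at hgap
  refine Continuous.tendsto' (by fun_prop) _ _ ?_
  rw [hdensity, hinv, ← mul_pow n p 2]
  have hmean : d * μ ^ 2 * (1 / (n * p)) ^ 2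
      - d * μ ^ 2 * (D / (n * p) * ((1 + 1) / 2) + (p - q) / (p + q) * ((1 - 1) / 2)) ^ 2
        = d * ((1 + D) / (n * p) ^ 2 * μ ^ 2) * (1 - D) := by
    ring
  linear_combination hmean + d * hgap
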